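/- arXiv:0711.0471 — 2 statements merged into one kernel-verified Lean document; each statement's English description precedes it below -/
import Mathlib

section
/- Let {X_n} be a stationary and ergodic time series with values in a finite or countably infinite set 𝒳 with κ_n = χ_{λ_n}. Then almost surely, for every j ≥ 0, X_{λ_j−κ_j+1}^{λ_j} = X̃_{−κ_j+1}^0, and on the event where κ_j → ∞ one has lim_{j→∞} d*(X̃⁰_{−∞}, X_{−∞}^{λ_j}) = 0. -/
open MeasureTheory Filter Set
open scoped ENNReal Topology

noncomputable section

namespace MWPrediction

/-- The canonical two-sided path space for a process with values in `𝒳`. -/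
abbrev Path (𝒳 : Type*) := ℤ → 𝒳

variable {𝒳 : Type*}

/-- The left shift `(T ω) i = ω (i+1)` on two-sided sequences. -/
def shift (ω : Path 𝒳) : Path 𝒳 := fun i => ω (i + 1)

/-- The one-sided past `X⁰_{-∞}`, recorded as `past ω i = X_{-i}`. -/
def past (ω : Path 𝒳) : ℕ → 𝒳 := fun i => ω (-(i : ℤ))

/-- The string `s` of length `m` (read right-to-left: `s j` is the symbol at
position `t - j`) occurs in `ω` ending at time `t`. -/
def OccursAt (ω : Path 𝒳) (m : ℕ) (s : ℕ → 𝒳) (t : ℤ) : Prop :=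
  ∀ j < m, ω (t - (j : ℤ)) = s j

/-- The auxiliary stopping times `ζ_n`:  `ζ_0 = 0` and `ζ_n` is obtained from
`ζ_{n-1}` by waiting for the recurrence of the block of length `l n` ending
at `ζ_{n-1}`. -/
def zeta (l : ℕ → ℕ) (ω : Path 𝒳) : ℕ → ℤ
  | 0 => 0
  | n + 1 =>
    zeta l ω n +
      ((sInf {t : ℕ | 0 < t ∧ ∀ s < l (n + 1),
          ω (zeta l ω n - (s : ℤ) + (t : ℤ)) = ω (zeta l ω n - (s : ℤ))} : ℕ) : ℤ)

/-- `J n = min { j ≥ 1 : l (j+1) > n }`. -/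
def Jfun (l : ℕ → ℕ) (n : ℕ) : ℕ := sInf {j : ℕ | 1 ≤ j ∧ n < l (j + 1)}

/-- The auxiliary process `X̃`: `tildePast l ω i = X̃_{-i} = X_{ζ_{J(i)} - i}`. -/
def tildePast (l : ℕ → ℕ) (ω : Path 𝒳) : ℕ → 𝒳 :=
  fun i => ω (zeta l ω (Jfun l i) - (i : ℤ))

variable [MeasurableSpace 𝒳]

/-- `pstr μ m s = P(X_{-m+1}^0 = s)`, the probability that the string `s` of
length `m` (read right-to-left) occupies positions `-m+1, …, 0`.
(So `pstr μ (k+1)` is `p_k` of the paper.) -/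
def pstr (μ : Measure (Path 𝒳)) (m : ℕ) (s : ℕ → 𝒳) : ℝ :=
  (μ {ω | ∀ j < m, ω (-(j : ℤ)) = s j}).toReal

/-- `pcond μ m y s = P(X_1 = y | X_{-m+1}^0 = s)`, conditioning on `m` symbols.
(So `pcond μ m` is `p_{m-1}(·|·)` of the paper.) -/
def pcond (μ : Measure (Path 𝒳)) (m : ℕ) (y : 𝒳) (s : ℕ → 𝒳) : ℝ :=
  (μ {ω | ω 1 = y ∧ ∀ j < m, ω (-(j : ℤ)) = s j}).toReal / pstr μ m s

/-- Append `y` as the new rightmost symbol of the string `s`. -/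
def withLast (y : 𝒳) (s : ℕ → 𝒳) : ℕ → 𝒳 := fun j => if j = 0 then y else s (j - 1)

/-- The string which agrees with `b` on its rightmost `k` symbols and continues
to the left with `z`:  this is the string `(z, b_{-k+1}^0)` of the paper. -/
def prependOld (b : ℕ → 𝒳) (k : ℕ) (z : ℕ → 𝒳) : ℕ → 𝒳 :=
  fun j => if j < k then b j else z (j - k)

/-- `K` is a memory bound for the past `b`: for all `i ≥ 1`, `y` and `z ∈ 𝒳^i`,
if `p_{K+i}(z, b_{-K+1}^0, y) > 0` then
`p_{K-1}(y | b_{-K+1}^0) = p_{K+i-1}(y | z, b_{-K+1}^0)`. -/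
def IsMemoryBound (μ : Measure (Path 𝒳)) (b : ℕ → 𝒳) (K : ℕ) : Prop :=
  ∀ i : ℕ, 1 ≤ i → ∀ y : 𝒳, ∀ z : ℕ → 𝒳,
    0 < pstr μ (K + i + 1) (withLast y (prependOld b K z)) →
    pcond μ K y b = pcond μ (K + i) y (prependOld b K z)

/-- The (random) memory length `K(b)` of a one-sided path `b`: the smallest
memory bound, and `∞` if there is none. -/
def memLen (μ : Measure (Path 𝒳)) (b : ℕ → 𝒳) : ℕ∞ :=
  sInf {n : ℕ∞ | ∃ K : ℕ, n = (K : ℕ∞) ∧ IsMemoryBound μ b K}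

/-- `Δ_k(b_{-k+1}^0)`. -/
def Delta (μ : Measure (Path 𝒳)) (k : ℕ) (b : ℕ → 𝒳) : ℝ :=
  sSup {d : ℝ | ∃ i : ℕ, 1 ≤ i ∧ ∃ z : ℕ → 𝒳, ∃ x : 𝒳,
    0 < pstr μ (k + i + 1) (withLast x (prependOld b k z)) ∧
    d = |pcond μ k x b - pcond μ (k + i) x (prependOld b k z)|}

/-- `⌈n/2⌉`. -/
def half (n : ℕ) : ℕ := (n + 1) / 2

open Classical in
/-- The number of times `t ∈ [a, b]` at which the string `s` of length `m`
occurs in `ω` ending at `t`. -/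
def cnt (ω : Path 𝒳) (m : ℕ) (s : ℕ → 𝒳) (a b : ℤ) : ℕ :=
  ((Finset.Icc a b).filter fun t => OccursAt ω m s t).card

/-- Membership in `ℒ_{n,m}^{(1)}`: the string `s` of length `m+1` occurs in
`X_0^{⌈n/2⌉ - 1}`. -/
def inL1 (ω : Path 𝒳) (n m : ℕ) (s : ℕ → 𝒳) : Prop :=
  ∃ t : ℤ, (m : ℤ) ≤ t ∧ t ≤ (half n : ℤ) - 1 ∧ OccursAt ω (m + 1) s t

/-- Membership in `ℒ_{n,m}^{(2)}`: the string `s` of length `m+1` occurs more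
than `n^{1-γ}` times in `X_{⌈n/2⌉}^n`. -/
def inL2 (γ : ℝ) (ω : Path 𝒳) (n m : ℕ) (s : ℕ → 𝒳) : Prop :=
  (n : ℝ) ^ (1 - γ) < (cnt ω (m + 1) s ((half n : ℤ) + (m : ℤ)) (n : ℤ) : ℝ)

/-- Membership in `ℒ_m^n = ℒ_{n,m}^{(1)} ∩ ℒ_{n,m}^{(2)}`. -/
def inL (γ : ℝ) (ω : Path 𝒳) (n m : ℕ) (s : ℕ → 𝒳) : Prop :=
  inL1 ω n m s ∧ inL2 γ ω n m s

/-- The empirical conditional relative frequency of `x` following the string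
`s` of length `m`, computed in the second half `X_{⌈n/2⌉}^n` of the data. -/
def empCond (ω : Path 𝒳) (n m : ℕ) (x : 𝒳) (s : ℕ → 𝒳) : ℝ :=
  (cnt ω (m + 1) (withLast x s) ((half n : ℤ) + (m : ℤ)) (n : ℤ) : ℝ) /
    (cnt ω m s ((half n : ℤ) + (m : ℤ) - 1) ((n : ℤ) - 1) : ℝ)

/-- The empirical statistic `Δ̂_k^n(X̃_{-k+1}^0)`. -/
def hatDelta (γ : ℝ) (l : ℕ → ℕ) (ω : Path 𝒳) (n k : ℕ) : ℝ :=
  (if zeta l ω (Jfun l k) ≤ (half n : ℤ) - 1 then (1 : ℝ) else 0) *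
    sSup {d : ℝ | ∃ i : ℕ, 1 ≤ i ∧ i ≤ n ∧ ∃ z : ℕ → 𝒳, ∃ x : 𝒳,
      inL γ ω n (k + i) (withLast x (prependOld (tildePast l ω) k z)) ∧
      d = |empCond ω n k x (tildePast l ω) -
            empCond ω n (k + i) x (prependOld (tildePast l ω) k z)|}

/-- The order estimate `χ_n`: the smallest `0 ≤ k < n` with `Δ̂_k^n ≤ n^{-β}`
(and `χ_0 = 0`). -/
def chi (β γ : ℝ) (l : ℕ → ℕ) (ω : Path 𝒳) (n : ℕ) : ℕ :=
  sInf {k : ℕ | k < n ∧ hatDelta γ l ω n k ≤ (n : ℝ) ^ (-β)}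

/-- The index `j` with `ζ_j ≤ v < ζ_{j+1}`. -/
def jIndex (l : ℕ → ℕ) (ω : Path 𝒳) (v : ℤ) : ℕ := sInf {j : ℕ | v < zeta l ω (j + 1)}

/-- The stopping times `λ_n`:  `λ_0 = 0` and, if `ζ_j ≤ λ_{n-1} < ζ_{j+1}`,
`λ_n = min { t > λ_{n-1} : X_{t - χ_t + 1}^t = X_{ζ_j - χ_t + 1}^{ζ_j} }`. -/
def lambda (β γ : ℝ) (l : ℕ → ℕ) (ω : Path 𝒳) : ℕ → ℤ
  | 0 => 0
  | n + 1 =>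
    lambda β γ l ω n + 1 +
      ((sInf {s : ℕ |
          ∀ r < chi β γ l ω (lambda β γ l ω n + 1 + (s : ℤ)).toNat,
            ω (lambda β γ l ω n + 1 + (s : ℤ) - (r : ℤ)) =
              ω (zeta l ω (jIndex l ω (lambda β γ l ω n)) - (r : ℤ))} : ℕ) : ℤ)

/-- `κ_n = χ_{λ_n}`. -/
def kappa (β γ : ℝ) (l : ℕ → ℕ) (ω : Path 𝒳) (n : ℕ) : ℕ :=
  chi β γ l ω (lambda β γ l ω n).toNat

/-- The estimator `f_n = (1/n) ∑_{j=0}^{n-1} f(X_{λ_j + 1})`. -/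
def fEst (β γ : ℝ) (l : ℕ → ℕ) (f : 𝒳 → ℝ) (ω : Path 𝒳) (n : ℕ) : ℝ :=
  (1 / (n : ℝ)) * ∑ j ∈ Finset.range n, f (ω (lambda β γ l ω j + 1))

open Classical in
/-- The metric `d*` on one-sided sequences. -/
def dstar (x y : ℕ → 𝒳) : ℝ :=
  ∑' i : ℕ, (2 : ℝ)⁻¹ ^ (i + 1) * (if x i ≠ y i then 1 else 0)

/-- `F` restricted to `C` is continuous with respect to the metric `d*`. -/
def ContinuousOnDstar (F : (ℕ → 𝒳) → ℝ) (C : Set (ℕ → 𝒳)) : Prop :=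
  ∀ x ∈ C, ∀ ε > 0, ∃ δ > 0, ∀ y ∈ C, dstar x y < δ → |F y - F x| < ε

/-- The σ-algebra generated by the one-sided past `X^0_{-∞}`. -/
def pastSigma (𝒳 : Type*) [MeasurableSpace 𝒳] : MeasurableSpace (Path 𝒳) :=
  MeasurableSpace.comap past inferInstance

/-- `F` is a version of the conditional expectation `E(f(X_1) | X^0_{-∞})`. -/
def IsPredictor (μ : Measure (Path 𝒳)) (f : 𝒳 → ℝ) (F : (ℕ → 𝒳) → ℝ) : Prop :=
  (fun ω => F (past ω)) =ᵐ[μ] μ[fun ω => f (ω 1)|pastSigma 𝒳]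

/-- `F` (a version of `E(f(X_1)|X^0_{-∞})`) is almost surely continuous:
it is continuous w.r.t. `d*` on a set of paths of probability one. -/
def ASContinuousCondExp (μ : Measure (Path 𝒳)) (F : (ℕ → 𝒳) → ℝ) : Prop :=
  ∃ C : Set (ℕ → 𝒳), μ (past ⁻¹' C) = 1 ∧ ContinuousOnDstar F C

/-- The observation `(λ_j, X_0^{λ_j})`, encoding the data segment available at
time `λ_j` (values before time `0` are clamped to `X_0`). -/
def segObs (β γ : ℝ) (l : ℕ → ℕ) (j : ℕ) (ω : Path 𝒳) : ℤ × (ℕ → 𝒳) :=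
  (lambda β γ l ω j, fun i => ω (max (lambda β γ l ω j - (i : ℤ)) 0))

/-- The σ-algebra generated by `(λ_j, X_0^{λ_j})`. -/
def segSigma (β γ : ℝ) (l : ℕ → ℕ) (j : ℕ) : MeasurableSpace (Path 𝒳) :=
  MeasurableSpace.comap (segObs β γ l j) inferInstance

/-- The observation `(λ_j, X_{-∞}^{λ_j})`: the full past at time `λ_j`. -/
def fullPastObs (β γ : ℝ) (l : ℕ → ℕ) (j : ℕ) (ω : Path 𝒳) : ℤ × (ℕ → 𝒳) :=
  (lambda β γ l ω j, fun i => ω (lambda β γ l ω j - (i : ℤ)))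

/-- The σ-algebra generated by `(λ_j, X_{-∞}^{λ_j})`. -/
def fullPastSigma (β γ : ℝ) (l : ℕ → ℕ) (j : ℕ) : MeasurableSpace (Path 𝒳) :=
  MeasurableSpace.comap (fullPastObs β γ l j) inferInstance

/-- The `n`-th term `-(1/(n+1)) ∑ p log₂ p` of the entropy rate. -/
def entropyTerm (μ : Measure (Path 𝒳)) (n : ℕ) : ℝ :=
  -(1 / ((n : ℝ) + 1)) *
    ∑' s : Fin (n + 1) → 𝒳,
      pstr μ (n + 1) (fun j => if h : j < n + 1 then s ⟨j, h⟩ else s ⟨0, Nat.succ_pos n⟩) *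
        Real.logb 2
          (pstr μ (n + 1) (fun j => if h : j < n + 1 then s ⟨j, h⟩ else s ⟨0, Nat.succ_pos n⟩))

/-- The process has entropy rate `H`. -/
def HasEntropyRate (μ : Measure (Path 𝒳)) (H : ℝ) : Prop :=
  Tendsto (entropyTerm μ) atTop (nhds H)

/-- The backward stopping times `ζ̂_i^k`. -/
def hatZeta (l : ℕ → ℕ) (k : ℕ) (ω : Path 𝒳) : ℕ → ℤ
  | 0 => 0
  | i + 1 =>
    hatZeta l k ω i -
      ((sInf {t : ℕ | 0 < t ∧ ∀ s < l (k - i),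
          ω (hatZeta l k ω i - (s : ℤ) - (t : ℤ)) = ω (hatZeta l k ω i - (s : ℤ))} : ℕ) : ℤ)


omit [MeasurableSpace 𝒳] in
theorem shift_iterate_apply (n : ℕ) (ω : Path 𝒳) (i : ℤ) :
    (shift^[n] ω) i = ω (i + n) := by
  induction n generalizing ω with
  | zero => simp
  | succ n ih =>
    rw [Function.iterate_succ_apply, ih, shift]
    congr 1
    push_cast
    ring

/-- Every finite block of `ω` occurs again at a later time. -/
def BlocksRecur (ω : Path 𝒳) : Prop :=
  ∀ (t : ℤ) (m : ℕ), ∃ s : ℕ, 0 < s ∧ ∀ r < m, ω (t - (r : ℤ) + (s : ℤ)) = ω (t - (r : ℤ))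

/-- Poincaré recurrence for finite blocks of a stationary process. -/
theorem ae_blocksRecur [Countable 𝒳] [MeasurableSingletonClass 𝒳]
    {μ : Measure (Path 𝒳)} [IsFiniteMeasure μ] (h : MeasurePreserving (shift : Path 𝒳 → _) μ μ) :
    ∀ᵐ ω ∂μ, BlocksRecur ω := by
  have key : ∀ (t : ℤ) (m : ℕ) (b : Fin m → 𝒳), ∀ᵐ ω ∂μ,
      ω ∈ {ω : Path 𝒳 | ∀ r : Fin m, ω (t - (r : ℕ)) = b r} →
        ∃ᶠ n in atTop, shift^[n] ω ∈ {ω : Path 𝒳 | ∀ r : Fin m, ω (t - (r : ℕ)) = b r} := by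
    intro t m b
    refine h.conservative.ae_mem_imp_frequently_image_mem (MeasurableSet.nullMeasurableSet ?_)
    rw [ofPred_forall]
    refine MeasurableSet.iInter fun r => ?_
    have hr : Measurable fun ω : Path 𝒳 => ω (t - (r : ℕ)) := measurable_pi_apply _
    exact hr (measurableSet_singleton (b r))
  simp_rw [← ae_all_iff] at key
  filter_upwards [key] with ω hω t m
  obtain ⟨s, hs, hmem⟩ :=
    frequently_atTop.1 (hω t m (fun r => ω (t - (r : ℕ))) fun _ => rfl) 1
  refine ⟨s, hs, fun r hr => ?_⟩
  simpa [shift_iterate_apply] using hmem ⟨r, hr⟩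

section Recurrence

omit [MeasurableSpace 𝒳]

variable {ω : Path 𝒳} {l : ℕ → ℕ}

theorem BlocksRecur.zeta_succ (h : BlocksRecur ω) (l : ℕ → ℕ) (n : ℕ) :
    zeta l ω n < zeta l ω (n + 1) ∧
      ∀ r < l (n + 1), ω (zeta l ω (n + 1) - (r : ℤ)) = ω (zeta l ω n - (r : ℤ)) := by
  obtain ⟨hpos, hmatch⟩ := Nat.sInf_mem (s := {t : ℕ | 0 < t ∧ ∀ s < l (n + 1),
    ω (zeta l ω n - (s : ℤ) + (t : ℤ)) = ω (zeta l ω n - (s : ℤ))}) (h (zeta l ω n) (l (n + 1)))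
  refine ⟨by rw [zeta]; omega, fun r hr => ?_⟩
  rw [← hmatch r hr, zeta]
  congr 1
  ring

theorem BlocksRecur.zeta_strictMono (h : BlocksRecur ω) (l : ℕ → ℕ) :
    StrictMono (zeta l ω) :=
  strictMono_nat_of_lt_succ fun n => (h.zeta_succ l n).1

theorem BlocksRecur.le_zeta (h : BlocksRecur ω) (l : ℕ → ℕ) (n : ℕ) : (n : ℤ) ≤ zeta l ω n := by
  induction n with
  | zero => simp [zeta]
  | succ n ih =>
    have := (h.zeta_succ l n).1
    push_cast
    omega

/-- Past position `r` of the block ending at `ζ_j` is the same for all `j` with `r < l (j + 1)`. -/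
theorem BlocksRecur.apply_zeta_eq (h : BlocksRecur ω) (hl : Monotone l) {i j r : ℕ}
    (hij : i ≤ j) (hr : r < l (i + 1)) :
    ω (zeta l ω j - (r : ℤ)) = ω (zeta l ω i - (r : ℤ)) := by
  induction j, hij using Nat.le_induction with
  | base => rfl
  | succ j hij ih =>
    rw [(h.zeta_succ l j).2 r (hr.trans_le (hl (by omega))), ih]

theorem jfun_mem (hltop : Tendsto l atTop atTop) (r : ℕ) :
    1 ≤ Jfun l r ∧ r < l (Jfun l r + 1) := by
  refine Nat.sInf_mem (s := {j : ℕ | 1 ≤ j ∧ r < l (j + 1)}) ?_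
  obtain ⟨N, hN⟩ := (hltop.eventually_gt_atTop r).exists_forall_of_atTop
  exact ⟨N + 1, by omega, hN _ (by omega)⟩

theorem BlocksRecur.apply_zeta_eq_tildePast (h : BlocksRecur ω) (hl : Monotone l)
    (hltop : Tendsto l atTop atTop) {j r : ℕ} (hr : r < l (j + 1)) :
    ω (zeta l ω j - (r : ℤ)) = tildePast l ω r := by
  rcases le_total (Jfun l r) j with hj | hj
  · exact h.apply_zeta_eq hl hj (jfun_mem hltop r).2
  · exact (h.apply_zeta_eq hl hj hr).symm

theorem chi_le_self (β γ : ℝ) (l : ℕ → ℕ) (ω : Path 𝒳) (n : ℕ) : chi β γ l ω n ≤ n := by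
  rcases Set.eq_empty_or_nonempty {k : ℕ | k < n ∧ hatDelta γ l ω n k ≤ (n : ℝ) ^ (-β)}
    with he | hne
  · simp [chi, he]
  · exact (Nat.sInf_mem hne).1.le

/-- Up to time `ζ_{j+1}` the order estimate is at most `l (j + 1)`. -/
theorem BlocksRecur.chi_le (h : BlocksRecur ω) (hl : Monotone l) (hltop : Tendsto l atTop atTop)
    (β γ : ℝ) {j n : ℕ} (hn : (n : ℤ) ≤ zeta l ω (j + 1)) :
    chi β γ l ω n ≤ l (j + 1) := by
  rcases le_or_gt n (l (j + 1)) with hle | hlt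
  · exact (chi_le_self β γ l ω n).trans hle
  refine Nat.sInf_le ⟨hlt, ?_⟩
  have hJ : j + 1 ≤ Jfun l (l (j + 1)) := by
    by_contra! hlt'
    exact ((jfun_mem hltop (l (j + 1))).2.trans_le (hl (by omega))).false
  have hz := (h.zeta_strictMono l).monotone hJ
  rw [hatDelta, if_neg (by unfold half; omega), zero_mul]
  positivity

theorem BlocksRecur.lambda_succ (h : BlocksRecur ω) (hl : Monotone l)
    (hltop : Tendsto l atTop atTop) (β γ : ℝ) {n : ℕ} (hn : 0 ≤ lambda β γ l ω n) :
    0 ≤ lambda β γ l ω (n + 1) ∧ ∀ r < kappa β γ l ω (n + 1),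
      ω (lambda β γ l ω (n + 1) - (r : ℤ)) = tildePast l ω r := by
  set v := lambda β γ l ω n with hv
  have hlt : v < zeta l ω (jIndex l ω v + 1) := by
    refine Nat.sInf_mem (s := {j : ℕ | v < zeta l ω (j + 1)}) ⟨v.toNat, ?_⟩
    have := h.le_zeta l (v.toNat + 1)
    simp only [mem_ofPred_eq]
    omega
  set j := jIndex l ω v with hj
  set S := {s : ℕ | ∀ r < chi β γ l ω (v + 1 + (s : ℤ)).toNat,
    ω (v + 1 + (s : ℤ) - (r : ℤ)) = ω (zeta l ω j - (r : ℤ))} with hS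
  have hlam : lambda β γ l ω (n + 1) = v + 1 + (sInf S : ℕ) := by rw [lambda]
  have hmem : (zeta l ω (j + 1) - (v + 1)).toNat ∈ S := by
    have heq : v + 1 + ((zeta l ω (j + 1) - (v + 1)).toNat : ℤ) = zeta l ω (j + 1) := by omega
    intro r hr
    rw [heq] at hr ⊢
    exact (h.zeta_succ l j).2 r (hr.trans_le (h.chi_le hl hltop β γ (by omega)))
  refine ⟨by omega, fun r hr => ?_⟩
  have hle := Nat.sInf_le hmem
  rw [kappa, hlam] at hr
  rw [hlam, Nat.sInf_mem ⟨_, hmem⟩ r hr]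
  exact h.apply_zeta_eq_tildePast hl hltop
    (hr.trans_le (h.chi_le hl hltop β γ (by omega)))

theorem BlocksRecur.apply_lambda_eq_tildePast (h : BlocksRecur ω) (hl : Monotone l)
    (hltop : Tendsto l atTop atTop) (β γ : ℝ) (n : ℕ) :
    ∀ r < kappa β γ l ω n, ω (lambda β γ l ω n - (r : ℤ)) = tildePast l ω r := by
  have hnonneg : ∀ n, 0 ≤ lambda β γ l ω n := fun n => by
    induction n with
    | zero => rfl
    | succ n ih => exact (h.lambda_succ hl hltop β γ ih).1
  cases n with
  | zero =>
    have := chi_le_self β γ l ω 0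
    intro r hr
    simp only [kappa, lambda, Int.toNat_zero] at hr
    omega
  | succ n => exact (h.lambda_succ hl hltop β γ (hnonneg n)).2

/-- Agreement on longer and longer initial segments implies convergence in `d*`. -/
theorem tendsto_dstar_zero {x : ℕ → 𝒳} {y : ℕ → ℕ → 𝒳} {k : ℕ → ℕ}
    (hk : Tendsto k atTop atTop) (hxy : ∀ j, ∀ r < k j, y j r = x r) :
    Tendsto (fun j => dstar x (y j)) atTop (𝓝 0) := by
  classical
  have hsum : Summable fun i : ℕ => (2 : ℝ)⁻¹ ^ (i + 1) :=
    (summable_nat_add_iff 1).2 (summable_geometric_of_lt_one (by norm_num) (by norm_num))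
  rw [← tsum_zero (α := ℝ) (β := ℕ)]
  refine tendsto_tsum_of_dominated_convergence hsum (fun i => ?_) (.of_forall fun j i => ?_)
  · refine tendsto_const_nhds.congr' ?_
    filter_upwards [hk.eventually_gt_atTop i] with j hj
    simp [hxy j i hj]
  · rw [norm_mul, Real.norm_of_nonneg (by positivity)]
    exact mul_le_of_le_one_right (by positivity) (by split_ifs <;> simp)

end Recurrence

/-- equation (9). Almost surely, for every `j` the block
`X_{λ_j-κ_j+1}^{λ_j}` equals `X̃_{-κ_j+1}^0`, and if `κ_j → ∞` then
`d*(X̃⁰_{-∞}, X_{-∞}^{λ_j}) → 0`. -/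
theorem statement16
    {𝒳 : Type*} [Countable 𝒳] [MeasurableSpace 𝒳] [MeasurableSingletonClass 𝒳]
    (μ : Measure (Path 𝒳)) [IsProbabilityMeasure μ]
    (hErg : Ergodic (shift : Path 𝒳 → Path 𝒳) μ)
    (l : ℕ → ℕ) (hl1 : l 1 = 1) (hlmono : Monotone l)
    (hlle : ∀ k, 1 ≤ k → l k ≤ k) (hltop : Tendsto l atTop atTop)
    (β γ : ℝ) (hγ0 : 0 < γ) (hγ1 : γ < 1) (hβ0 : 0 < β) (hβγ : 2 * β + γ < 1) :
    ∀ᵐ ω ∂μ,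
      (∀ j : ℕ, ∀ r < kappa β γ l ω j,
        ω (lambda β γ l ω j - (r : ℤ)) = tildePast l ω r) ∧
      (Tendsto (fun j => kappa β γ l ω j) atTop atTop →
        Tendsto (fun j => dstar (tildePast l ω) fun i => ω (lambda β γ l ω j - (i : ℤ)))
          atTop (nhds 0)) := by
  filter_upwards [ae_blocksRecur hErg.toMeasurePreserving] with ω hω
  have hmatch := hω.apply_lambda_eq_tildePast hlmono hltop β γ
  exact ⟨hmatch, fun hk => tendsto_dstar_zero hk hmatch⟩

end MWPrediction
end
end

section
/- Every stationary finitarily Markovian time series {X_n} with values in a finite or countably infinite set 𝒳 has, for every bounded f : 𝒳 → ℝ, an almost surely continuous conditional expectation F(X⁰_{−∞}) = E(f(X_1)|X⁰_{−∞}): there is a set C ⊆ 𝒳^{*−} of probability one such that F restricted to C is continuous with respect to the metric d*. -/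
open MeasureTheory Filter Set
open scoped ENNReal Topology

noncomputable section

namespace MWPrediction

variable {𝒳 : Type*}

variable [MeasurableSpace 𝒳]

theorem ae_measure_fiber_ne_zero {Ω β : Type*} {mΩ : MeasurableSpace Ω}
    [Countable β] [MeasurableSpace β] [MeasurableSingletonClass β]
    (μ : Measure Ω) {X : Ω → β} (hX : Measurable X) : ∀ᵐ ω ∂μ, μ (X ⁻¹' {X ω}) ≠ 0 := by
  have h : ∀ᵐ b ∂(μ.map X), (μ.map X) {b} ≠ 0 := ae_iff_of_countable.2 fun _ hb => hb
  filter_upwards [ae_of_ae_map hX.aemeasurable h] with ω hω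
  rwa [Measure.map_apply hX (measurableSet_singleton _)] at hω

/-- The conditional expectation given a random variable with countably many values is
almost surely the average over the fibre. -/
theorem condExp_comap_ae_eq_integral_cond {Ω β : Type*} {mΩ : MeasurableSpace Ω}
    [Countable β] [MeasurableSpace β] [MeasurableSingletonClass β]
    (μ : Measure Ω) [IsProbabilityMeasure μ] {X : Ω → β} (hX : Measurable X)
    {g : Ω → ℝ} (hg : Integrable g μ) :
    ∀ᵐ ω ∂μ, (μ[g | MeasurableSpace.comap X inferInstance]) ω =
      ∫ x, g x ∂(ProbabilityTheory.cond μ (X ⁻¹' {X ω})) := by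
  filter_upwards [ae_measure_fiber_ne_zero μ hX] with ω hω
  have hA : MeasurableSet (X ⁻¹' {X ω}) := hX (measurableSet_singleton _)
  have hconst : ∀ x ∈ X ⁻¹' {X ω}, (μ[g | MeasurableSpace.comap X inferInstance]) x =
      (μ[g | MeasurableSpace.comap X inferInstance]) ω := fun x hx =>
    StronglyMeasurable.factorsThrough (stronglyMeasurable_condExp (f := g) (μ := μ)) hx
  have hint := setIntegral_condExp (μ := μ) hX.comap_le hg
    (s := X ⁻¹' {X ω}) ⟨{X ω}, measurableSet_singleton _, rfl⟩
  rw [setIntegral_congr_fun hA hconst, setIntegral_const, smul_eq_mul] at hint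
  have hne : μ.real (X ⁻¹' {X ω}) ≠ 0 := by
    simpa [measureReal_def, ENNReal.toReal_eq_zero_iff] using hω
  rw [ProbabilityTheory.cond, integral_smul_measure, ← hint, ENNReal.toReal_inv,
    ← measureReal_def, smul_eq_mul, inv_mul_cancel_left₀ hne]

/-- Two probability measures on a countable space coincide as soon as they agree on the
atoms of one of them. -/
theorem eq_of_forall_singleton_ne_zero {α : Type*} [Countable α] [MeasurableSpace α]
    [MeasurableSingletonClass α] {ν ρ : Measure α} [IsProbabilityMeasure ν]
    [IsProbabilityMeasure ρ] (h : ∀ a, ρ {a} ≠ 0 → ν {a} = ρ {a}) : ν = ρ := by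
  refine (Measure.eq_of_le_of_isProbabilityMeasure ?_).symm
  refine Measure.le_iff.2 fun s _ => ?_
  rw [← Measure.tsum_indicator_apply_singleton ρ s (Set.to_countable s).measurableSet,
    ← Measure.tsum_indicator_apply_singleton ν s (Set.to_countable s).measurableSet]
  refine ENNReal.tsum_le_tsum fun a => Set.indicator_le_indicator ?_
  by_cases ha : ρ {a} = 0
  · simp [ha]
  · exact (h a ha).ge

/-- The paths whose last `m` symbols up to time `0` agree with `b`. -/
def cylinder (m : ℕ) (b : ℕ → 𝒳) : Set (Path 𝒳) := {ω | ∀ j < m, ω (-(j : ℤ)) = b j}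

/-- The conditional distribution of `X_1` given the last `m` symbols `b`. -/
def nextLaw (μ : Measure (Path 𝒳)) (m : ℕ) (b : ℕ → 𝒳) : Measure 𝒳 :=
  (ProbabilityTheory.cond μ (cylinder m b)).map fun ω => ω 1

/-- The last `m` symbols up to time `0`. -/
def window (m : ℕ) (ω : Path 𝒳) : Fin m → 𝒳 := fun j => ω (-((j : ℕ) : ℤ))

theorem cylinder_congr {𝒳 : Type*} {m : ℕ} {b c : ℕ → 𝒳} (h : ∀ j < m, b j = c j) :
    cylinder m b = cylinder m c :=
  Set.ext fun _ => forall₂_congr fun j hj => by rw [h j hj]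

theorem cylinder_past {𝒳 : Type*} (m : ℕ) (ω : Path 𝒳) :
    cylinder m (past ω) = window m ⁻¹' {window m ω} := by
  ext η
  simp [cylinder, window, past, funext_iff, Fin.forall_iff]

theorem measurable_past : Measurable (past : Path 𝒳 → ℕ → 𝒳) :=
  measurable_pi_lambda _ fun _ => measurable_pi_apply _

theorem measurable_window (m : ℕ) : Measurable (window m : Path 𝒳 → Fin m → 𝒳) :=
  measurable_pi_lambda _ fun _ => measurable_pi_apply _

theorem measurableSet_cylinder [MeasurableSingletonClass 𝒳] (m : ℕ) (b : ℕ → 𝒳) :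
    MeasurableSet (cylinder m b) := by
  have : cylinder m b = ⋂ j, ⋂ _ : j < m, (fun ω : Path 𝒳 => ω (-(j : ℤ))) ⁻¹' {b j} := by
    ext; simp [cylinder]
  rw [this]
  exact .iInter fun j => .iInter fun _ => measurable_pi_apply _ (measurableSet_singleton _)

theorem pcond_eq_nextLaw [MeasurableSingletonClass 𝒳] (μ : Measure (Path 𝒳))
    (m : ℕ) (y : 𝒳) (b : ℕ → 𝒳) : pcond μ m y b = (nextLaw μ m b {y}).toReal := by
  rw [nextLaw, Measure.map_apply (measurable_pi_apply _) (measurableSet_singleton _),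
    ProbabilityTheory.cond_apply (measurableSet_cylinder m b), ENNReal.toReal_mul,
    ENNReal.toReal_inv, pcond, pstr, div_eq_inv_mul, Set.inter_comm]
  rfl

theorem pstr_withLast [MeasurableSingletonClass 𝒳] {μ : Measure (Path 𝒳)}
    (hStat : MeasurePreserving (shift : Path 𝒳 → Path 𝒳) μ μ) (m : ℕ) (y : 𝒳) (b : ℕ → 𝒳) :
    pstr μ (m + 1) (withLast y b) =
      (μ (cylinder m b ∩ (fun ω : Path 𝒳 => ω 1) ⁻¹' {y})).toReal := by
  change (μ (cylinder (m + 1) (withLast y b))).toReal = _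
  rw [← hStat.measure_preimage
    (measurableSet_cylinder (m + 1) (withLast y b)).nullMeasurableSet]
  congr 2
  ext ω
  constructor
  · intro h
    refine ⟨fun j hj => ?_, ?_⟩
    · simpa [shift, withLast] using h (j + 1) (by omega)
    · simpa [shift, withLast] using h 0 (by omega)
  · rintro ⟨h, h1⟩ (_ | j) hj
    · simpa [shift, withLast] using h1
    · simpa [shift, withLast] using h j (by omega)

theorem prependOld_drop {𝒳 : Type*} (b : ℕ → 𝒳) (k : ℕ) : prependOld b k (fun j => b (k + j)) = b := by
  ext j
  by_cases h : j < k
  · simp [prependOld, h]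
  · simp [prependOld, h, Nat.add_sub_cancel' (not_lt.1 h)]

theorem isProbabilityMeasure_nextLaw {μ : Measure (Path 𝒳)} [IsProbabilityMeasure μ]
    {m : ℕ} {b : ℕ → 𝒳} (hb : μ (cylinder m b) ≠ 0) : IsProbabilityMeasure (nextLaw μ m b) := by
  have := ProbabilityTheory.cond_isProbabilityMeasure hb
  exact Measure.isProbabilityMeasure_map (measurable_pi_apply _).aemeasurable

/-- Beyond a memory bound, longer pasts do not change the law of the next symbol. -/
theorem nextLaw_eq_of_isMemoryBound [Countable 𝒳] [MeasurableSingletonClass 𝒳]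
    {μ : Measure (Path 𝒳)} [IsProbabilityMeasure μ]
    (hStat : MeasurePreserving (shift : Path 𝒳 → Path 𝒳) μ μ) {b : ℕ → 𝒳} {K m : ℕ}
    (hK : IsMemoryBound μ b K) (hKm : K ≤ m) (hb : ∀ n, μ (cylinder n b) ≠ 0) :
    nextLaw μ K b = nextLaw μ m b := by
  rcases hKm.eq_or_lt with rfl | hlt
  · rfl
  obtain ⟨i, rfl⟩ := Nat.exists_eq_add_of_le hKm
  have := isProbabilityMeasure_nextLaw (hb K)
  have := isProbabilityMeasure_nextLaw (hb (K + i))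
  refine eq_of_forall_singleton_ne_zero fun y hy => ?_
  have h := hK i (by omega) y fun j => b (K + j)
  rw [prependOld_drop, pstr_withLast hStat, pcond_eq_nextLaw, pcond_eq_nextLaw,
    ENNReal.toReal_eq_toReal_iff' (measure_ne_top _ _) (measure_ne_top _ _)] at h
  refine h (ENNReal.toReal_pos (fun h0 => hy ?_) (measure_ne_top _ _))
  rw [nextLaw, Measure.map_apply (measurable_pi_apply _) (measurableSet_singleton _),
    ProbabilityTheory.cond_apply (measurableSet_cylinder _ b), h0, mul_zero]

theorem isMemoryBound_congr {μ : Measure (Path 𝒳)} {b c : ℕ → 𝒳} {K : ℕ}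
    (h : ∀ j < K, b j = c j) : IsMemoryBound μ b K ↔ IsMemoryBound μ c K := by
  have hpre : ∀ z, prependOld b K z = prependOld c K z := fun z => funext fun j => by
    by_cases hj : j < K
    · simp [prependOld, hj, h j hj]
    · simp [prependOld, hj]
  have hcyl := cylinder_congr h
  have hpc : ∀ y, pcond μ K y b = pcond μ K y c := fun y => by
    have h1 : pstr μ K b = pstr μ K c := congrArg (fun s => (μ s).toReal) hcyl
    have h2 : {ω : Path 𝒳 | ω 1 = y ∧ ∀ j < K, ω (-(j : ℤ)) = b j} =
        {ω | ω 1 = y ∧ ∀ j < K, ω (-(j : ℤ)) = c j} :=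
      congrArg (fun s => {ω : Path 𝒳 | ω 1 = y} ∩ s) hcyl
    rw [pcond, pcond, h1, h2]
  simp only [IsMemoryBound, hpre, hpc]

theorem memLen_ne_top_iff {μ : Measure (Path 𝒳)} {b : ℕ → 𝒳} :
    memLen μ b ≠ ⊤ ↔ ∃ K, IsMemoryBound μ b K := by
  rw [memLen, Ne, sInf_eq_top]
  push Not
  constructor
  · rintro ⟨_, ⟨K, rfl, hK⟩, -⟩
    exact ⟨K, hK⟩
  · rintro ⟨K, hK⟩
    exact ⟨K, ⟨K, rfl, hK⟩, ENat.natCast_ne_top K⟩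

/-- The least memory bound of `b` (and `0` if there is none). -/
def leastMemory (μ : Measure (Path 𝒳)) (b : ℕ → 𝒳) : ℕ := sInf {K | IsMemoryBound μ b K}

/-- The expectation of `f(X_1)` given the part of the past `b` within its memory length. -/
def memoryPredictor (μ : Measure (Path 𝒳)) (f : 𝒳 → ℝ) (b : ℕ → 𝒳) : ℝ :=
  ∫ x, f x ∂(nextLaw μ (leastMemory μ b) b)

theorem isMemoryBound_leastMemory {μ : Measure (Path 𝒳)} {b : ℕ → 𝒳} (h : memLen μ b ≠ ⊤) :
    IsMemoryBound μ b (leastMemory μ b) :=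
  Nat.sInf_mem (memLen_ne_top_iff.1 h)

theorem memoryPredictor_congr {μ : Measure (Path 𝒳)} {f : 𝒳 → ℝ} {b c : ℕ → 𝒳}
    (hb : memLen μ b ≠ ⊤) (h : ∀ j < leastMemory μ b, b j = c j) :
    memoryPredictor μ f b = memoryPredictor μ f c := by
  have hc : IsMemoryBound μ c (leastMemory μ b) :=
    (isMemoryBound_congr h).1 (isMemoryBound_leastMemory hb)
  have hle : leastMemory μ c ≤ leastMemory μ b := Nat.sInf_le hc
  have hc' : IsMemoryBound μ c (leastMemory μ c) :=
    isMemoryBound_leastMemory (memLen_ne_top_iff.2 ⟨_, hc⟩)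
  have hge : leastMemory μ b ≤ leastMemory μ c :=
    Nat.sInf_le ((isMemoryBound_congr fun j hj => h j (hj.trans_le hle)).2 hc')
  rw [memoryPredictor, memoryPredictor, ← le_antisymm hle hge, nextLaw, nextLaw,
    cylinder_congr fun j hj => h j (hj.trans_le hle)]

theorem eq_of_dstar_lt {𝒳 : Type*} {x y : ℕ → 𝒳} {m : ℕ} (h : dstar x y < (2 : ℝ)⁻¹ ^ (m + 1)) :
    ∀ j < m, x j = y j := by
  classical
  intro j hj
  by_contra hne
  have hnn : ∀ i : ℕ, 0 ≤ (2 : ℝ)⁻¹ ^ (i + 1) * (if x i ≠ y i then 1 else 0) := fun i => by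
    positivity
  have hs : Summable fun i : ℕ => (2 : ℝ)⁻¹ ^ (i + 1) * (if x i ≠ y i then 1 else 0) := by
    refine .of_nonneg_of_le hnn (fun i => ?_)
      ((summable_nat_add_iff 1).2
        (summable_geometric_of_lt_one (r := (2 : ℝ)⁻¹) (by norm_num) (by norm_num)))
    refine mul_le_of_le_one_right (by positivity) ?_
    split_ifs <;> norm_num
  have hle : (2 : ℝ)⁻¹ ^ (j + 1) ≤ dstar x y :=
    calc (2 : ℝ)⁻¹ ^ (j + 1) = (2 : ℝ)⁻¹ ^ (j + 1) * (if x j ≠ y j then 1 else 0) := by simp [hne]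
      _ ≤ dstar x y := hs.le_tsum j fun i _ => hnn i
  have : (2 : ℝ)⁻¹ ^ (m + 1) ≤ (2 : ℝ)⁻¹ ^ (j + 1) :=
    pow_le_pow_of_le_one (by norm_num) (by norm_num) (by omega)
  linarith

theorem continuousOnDstar_memoryPredictor (μ : Measure (Path 𝒳)) (f : 𝒳 → ℝ) :
    ContinuousOnDstar (memoryPredictor μ f) {b | memLen μ b ≠ ⊤} := fun x hx ε hε =>
  ⟨(2 : ℝ)⁻¹ ^ (leastMemory μ x + 1), by positivity, fun y _ hxy => by
    rwa [memoryPredictor_congr hx (eq_of_dstar_lt hxy), sub_self, abs_zero]⟩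

/-- The filtration generated by the finite windows ending at time `0`. -/
def windowFiltration (𝒳 : Type*) [MeasurableSpace 𝒳] :
    Filtration ℕ (inferInstance : MeasurableSpace (Path 𝒳)) where
  seq m := MeasurableSpace.comap (window m) inferInstance
  mono' m n hmn := by
    have h : (window m : Path 𝒳 → Fin m → 𝒳) =
        (fun v (j : Fin m) => v (Fin.castLE hmn j)) ∘ window n := rfl
    have hm : Measurable fun (v : Fin n → 𝒳) (j : Fin m) => v (Fin.castLE hmn j) :=
      measurable_pi_lambda _ fun _ => measurable_pi_apply _
    dsimp only
    rw [h, ← MeasurableSpace.comap_comp]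
    exact MeasurableSpace.comap_mono hm.comap_le
  le' m := (measurable_window m).comap_le

theorem iSup_windowFiltration : ⨆ m, windowFiltration 𝒳 m = pastSigma 𝒳 := by
  apply le_antisymm
  · refine iSup_le fun m => ?_
    have h : (window m : Path 𝒳 → Fin m → 𝒳) = (fun b (j : Fin m) => b j) ∘ past := rfl
    have hm : Measurable fun (b : ℕ → 𝒳) (j : Fin m) => b j :=
      measurable_pi_lambda _ fun _ => measurable_pi_apply _
    change MeasurableSpace.comap (window m) _ ≤ _
    rw [h, ← MeasurableSpace.comap_comp]
    exact MeasurableSpace.comap_mono hm.comap_le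
  · have h : Measurable[⨆ m, windowFiltration 𝒳 m] (past : Path 𝒳 → ℕ → 𝒳) := by
      refine @measurable_pi_lambda _ _ _ (_) _ _ fun j => ?_
      have hj : Measurable[windowFiltration 𝒳 (j + 1)] fun ω : Path 𝒳 => past ω j :=
        (measurable_pi_apply (Fin.last j)).comp (comap_measurable (window (j + 1)))
      exact hj.mono (le_iSup (fun m => (windowFiltration 𝒳 m : MeasurableSpace _)) (j + 1)) le_rfl
    exact h.comap_le

theorem ae_cylinder_past_ne_zero [Countable 𝒳] [MeasurableSingletonClass 𝒳]
    (μ : Measure (Path 𝒳)) : ∀ᵐ ω ∂μ, ∀ m, μ (cylinder m (past ω)) ≠ 0 := by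
  refine ae_all_iff.2 fun m => ?_
  simp only [cylinder_past]
  exact ae_measure_fiber_ne_zero μ (measurable_window m)

theorem isPredictor_memoryPredictor [Countable 𝒳] [MeasurableSingletonClass 𝒳]
    {μ : Measure (Path 𝒳)} [IsProbabilityMeasure μ]
    (hStat : MeasurePreserving (shift : Path 𝒳 → Path 𝒳) μ μ)
    (hFM : ∀ᵐ ω ∂μ, memLen μ (past ω) ≠ ⊤) {f : 𝒳 → ℝ} {M : ℝ} (hf : ∀ x, |f x| ≤ M) :
    IsPredictor μ f (memoryPredictor μ f) := by
  have hfm : StronglyMeasurable f := (measurable_of_countable f).stronglyMeasurable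
  have hint : Integrable (fun ω : Path 𝒳 => f (ω 1)) μ :=
    .of_bound (hfm.comp_measurable (measurable_pi_apply 1)).aestronglyMeasurable M
      (.of_forall fun ω => hf (ω 1))
  have hlim := tendsto_ae_condExp (μ := μ) (ℱ := windowFiltration 𝒳) fun ω => f (ω 1)
  rw [iSup_windowFiltration] at hlim
  have hwin := ae_all_iff.2 fun m =>
    condExp_comap_ae_eq_integral_cond μ (measurable_window m) hint
  filter_upwards [hFM, hlim, hwin, ae_cylinder_past_ne_zero μ] with ω hω hlimω hwinω hposω
  refine tendsto_nhds_unique (tendsto_const_nhds.congr' ?_) hlimω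
  filter_upwards [eventually_ge_atTop (leastMemory μ (past ω))] with m hm
  rw [memoryPredictor,
    nextLaw_eq_of_isMemoryBound hStat (isMemoryBound_leastMemory hω) hm hposω, nextLaw,
    integral_map (measurable_pi_apply _).aemeasurable hfm.aestronglyMeasurable, cylinder_past]
  exact (hwinω m).symm

/-- Every stationary finitarily Markovian process has, for
every bounded `f`, an almost surely continuous conditional expectation
`F(X⁰_{-∞}) = E(f(X_1) | X⁰_{-∞})`. -/
theorem statement17
    {𝒳 : Type*} [Countable 𝒳] [MeasurableSpace 𝒳] [MeasurableSingletonClass 𝒳]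
    (μ : Measure (Path 𝒳)) [IsProbabilityMeasure μ]
    (hStat : MeasurePreserving (shift : Path 𝒳 → Path 𝒳) μ μ)
    (hFM : ∀ᵐ ω ∂μ, memLen μ (past ω) ≠ ⊤) :
    ∀ f : 𝒳 → ℝ, (∃ M, ∀ x, |f x| ≤ M) →
      ∃ F : (ℕ → 𝒳) → ℝ, IsPredictor μ f F ∧ ASContinuousCondExp μ F := by
  rintro f ⟨M, hf⟩
  refine ⟨memoryPredictor μ f, isPredictor_memoryPredictor hStat hFM hf,
    {b | memLen μ b ≠ ⊤}, ?_, continuousOnDstar_memoryPredictor μ f⟩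
  exact (measure_congr (eventuallyEq_univ.2 hFM)).trans measure_univ

end MWPrediction
end
end
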